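/- Let λ = (λ₁ ≥ λ₂ ≥ ⋯ ≥ λ_k) be an integer partition of n into k parts. Then, for u ∈ {ℓ, c}, M^u(λ) = Σ_{1≤i<j≤k} M^u(λ_i, λ_j), where M^u(a,b) denotes M^u applied to the two-part integer partition with parts a and b (a ≥ b), i.e. the maximum of cr^u over set partitions of [a+b] with two blocks of sizes a and b. -/

import Mathlib

open Finset

/-- Two elements lie in the same block of the set partition `π` of `[n]`. -/
def sameBlock {n : ℕ} (π : Finpartition (univ : Finset (Fin n))) (a b : Fin n) : Prop :=
  ∃ B ∈ π.parts, a ∈ B ∧ b ∈ B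

/-- `(a, b)` is an arc of `π`: `a < b`, they lie in a common block, and no element of that
block lies strictly between them. -/
def IsArc {n : ℕ} (π : Finpartition (univ : Finset (Fin n))) (a b : Fin n) : Prop :=
  a < b ∧ sameBlock π a b ∧ ∀ c : Fin n, a < c → c < b → ¬ sameBlock π a c

/-- The linear crossing number `cr^ℓ(π)`: the number of pairs of arcs
`((a,b),(c,d))` with `a < c < b < d`. -/
noncomputable def crl {n : ℕ} (π : Finpartition (univ : Finset (Fin n))) : ℕ :=
  Set.ncard {q : (Fin n × Fin n) × (Fin n × Fin n) |
    IsArc π q.1.1 q.1.2 ∧ IsArc π q.2.1 q.2.2 ∧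
    q.1.1 < q.2.1 ∧ q.2.1 < q.1.2 ∧ q.1.2 < q.2.2}

/-- `(a, b)` is a chord of `π`: `a < b` lie in a common block `B`, and either they are
consecutive elements of `B`, or `B` has at least 3 elements and `a = min B`, `b = max B`. -/
def IsChord {n : ℕ} (π : Finpartition (univ : Finset (Fin n))) (a b : Fin n) : Prop :=
  a < b ∧ ∃ B ∈ π.parts, a ∈ B ∧ b ∈ B ∧
    ((∀ c ∈ B, ¬(a < c ∧ c < b)) ∨ (3 ≤ B.card ∧ ∀ c ∈ B, a ≤ c ∧ c ≤ b))

/-- The circular crossing number `cr^c(π)`: the number of unordered pairs of crossing chords,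
counted as ordered pairs `((a,b),(c,d))` of chords with `a < c < b < d`. -/
noncomputable def crc {n : ℕ} (π : Finpartition (univ : Finset (Fin n))) : ℕ :=
  Set.ncard {q : (Fin n × Fin n) × (Fin n × Fin n) |
    IsChord π q.1.1 q.1.2 ∧ IsChord π q.2.1 q.2.2 ∧
    q.1.1 < q.2.1 ∧ q.2.1 < q.1.2 ∧ q.1.2 < q.2.2}

/-- The Stirling number of the second kind `S(n,k)`: the number of set partitions of `[n]`
into exactly `k` blocks. -/
noncomputable def stirling (n k : ℕ) : ℕ :=
  Nat.card {π : Finpartition (univ : Finset (Fin n)) // π.parts.card = k}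

/-- Stirling numbers with integer arguments: `S(m,j) = 0` unless `0 ≤ j ≤ m`. -/
noncomputable def stirlingZ (m j : ℤ) : ℕ :=
  if 0 ≤ m ∧ 0 ≤ j then stirling m.toNat j.toNat else 0

/-- The Bell number `B_n`: the number of set partitions of `[n]`. -/
noncomputable def bell (n : ℕ) : ℕ :=
  Nat.card (Finpartition (univ : Finset (Fin n)))

/-- The set partitions of `[n]` with exactly `k` blocks, as a `Finset`. -/
def Pik (n k : ℕ) : Finset (Finpartition (univ : Finset (Fin n))) :=
  Finset.univ.filter fun π => π.parts.card = k

/-- The mean of the linear crossing number over `Π_n^k`. -/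
noncomputable def EX (n k : ℕ) : ℝ :=
  (∑ π ∈ Pik n k, (crl π : ℝ)) / stirling n k

/-- The variance of the linear crossing number over `Π_n^k`. -/
noncomputable def VarX (n k : ℕ) : ℝ :=
  (∑ π ∈ Pik n k, (crl π : ℝ) ^ 2) / stirling n k - EX n k ^ 2

/-- The mean of the circular crossing number over `Π_n^k`. -/
noncomputable def EY (n k : ℕ) : ℝ :=
  (∑ π ∈ Pik n k, (crc π : ℝ)) / stirling n k

/-- The variance of the circular crossing number over `Π_n^k`. -/
noncomputable def VarY (n k : ℕ) : ℝ :=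
  (∑ π ∈ Pik n k, (crc π : ℝ) ^ 2) / stirling n k - EY n k ^ 2

/-- The mean of the linear crossing number over all of `Π_n`. -/
noncomputable def EXall (n : ℕ) : ℝ :=
  (∑ π : Finpartition (univ : Finset (Fin n)), (crl π : ℝ)) / bell n

/-- The variance of the linear crossing number over all of `Π_n`. -/
noncomputable def VarXall (n : ℕ) : ℝ :=
  (∑ π : Finpartition (univ : Finset (Fin n)), (crl π : ℝ) ^ 2) / bell n - EXall n ^ 2

/-- The mean of the circular crossing number over all of `Π_n`. -/
noncomputable def EYall (n : ℕ) : ℝ :=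
  (∑ π : Finpartition (univ : Finset (Fin n)), (crc π : ℝ)) / bell n

/-- The variance of the circular crossing number over all of `Π_n`. -/
noncomputable def VarYall (n : ℕ) : ℝ :=
  (∑ π : Finpartition (univ : Finset (Fin n)), (crc π : ℝ) ^ 2) / bell n - EYall n ^ 2

/-- The standard normal distribution function `Φ`. -/
noncomputable def stdNormalCDF (x : ℝ) : ℝ :=
  (Real.sqrt (2 * Real.pi))⁻¹ * ∫ t in Set.Iic x, Real.exp (-t ^ 2 / 2)

/-- `maxCrl N sizes` is the maximum of the linear crossing number over all set partitions of
`[N]` whose multiset of block sizes is `sizes`. -/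
noncomputable def maxCrl (N : ℕ) (sizes : Multiset ℕ) : ℕ :=
  sSup {c : ℕ | ∃ π : Finpartition (univ : Finset (Fin N)),
    Multiset.map Finset.card π.parts.val = sizes ∧ crl π = c}

/-- `maxCrc N sizes` is the maximum of the circular crossing number over all set partitions of
`[N]` whose multiset of block sizes is `sizes`. -/
noncomputable def maxCrc (N : ℕ) (sizes : Multiset ℕ) : ℕ :=
  sSup {c : ℕ | ∃ π : Finpartition (univ : Finset (Fin N)),
    Multiset.map Finset.card π.parts.val = sizes ∧ crc π = c}

/-! ### Crossings of coloured relations -/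

namespace ColoredCrossing

variable {n k : ℕ}

/-- `a < b` are consecutive elements of a colour class of `f`. -/
def Arc (f : Fin n → Fin k) (a b : Fin n) : Prop :=
  a < b ∧ f a = f b ∧ ∀ c, f c = f a → ¬(a < c ∧ c < b)

/-- `a < b` are cyclically consecutive elements of a colour class of `f`. -/
def Chord (f : Fin n → Fin k) (a b : Fin n) : Prop :=
  a < b ∧ f a = f b ∧ ((∀ c, f c = f a → ¬(a < c ∧ c < b)) ∨
    (3 ≤ #{c | f c = f a} ∧ ∀ c, f c = f a → a ≤ c ∧ c ≤ b))

open Classical in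
/-- The crossing pairs of a relation `R` on `Fin n`. -/
noncomputable def crossings (R : Fin n → Fin n → Prop) :
    Finset ((Fin n × Fin n) × (Fin n × Fin n)) :=
  {q | R q.1.1 q.1.2 ∧ R q.2.1 q.2.2 ∧ q.1.1 < q.2.1 ∧ q.2.1 < q.1.2 ∧ q.1.2 < q.2.2}

/-- The crossing pairs of `R` whose first member has colour `i` and whose second has colour `j`. -/
noncomputable def crossingsOf (f : Fin n → Fin k) (R : Fin n → Fin n → Prop) (i j : Fin k) :
    Finset ((Fin n × Fin n) × (Fin n × Fin n)) :=
  {q ∈ crossings R | f q.1.1 = i ∧ f q.2.1 = j}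

lemma mem_crossings {R : Fin n → Fin n → Prop} {a b c d : Fin n} :
    ((a, b), (c, d)) ∈ crossings R ↔ R a b ∧ R c d ∧ a < c ∧ c < b ∧ b < d := by
  simp [crossings]

lemma mem_crossingsOf {f : Fin n → Fin k} {R : Fin n → Fin n → Prop} {i j : Fin k}
    {a b c d : Fin n} :
    ((a, b), (c, d)) ∈ crossingsOf f R i j ↔
      (R a b ∧ R c d ∧ a < c ∧ c < b ∧ b < d) ∧ f a = i ∧ f c = j := by
  simp [crossingsOf, mem_crossings]

lemma Arc.chord {f : Fin n → Fin k} {a b : Fin n} (h : Arc f a b) : Chord f a b :=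
  ⟨h.1, h.2.1, Or.inl h.2.2⟩

lemma color_ne_of_chord {f : Fin n → Fin k} {a b c d : Fin n} (h : Chord f a b)
    (h' : Chord f c d) (hac : a < c) (hcb : c < b) (hbd : b < d) : f a ≠ f c := by
  rintro hf
  rcases h.2.2 with h₁ | ⟨-, h₁⟩
  · exact h₁ c hf.symm ⟨hac, hcb⟩
  · exact absurd (h₁ d (hf.trans h'.2.1).symm).2 (not_le.2 hbd)

lemma card_crossings (f : Fin n → Fin k) (R : Fin n → Fin n → Prop)
    (hR : ∀ a b, R a b → Chord f a b) :
    #(crossings R) = ∑ p : Fin k × Fin k with p.1 < p.2,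
      (#(crossingsOf f R p.1 p.2) + #(crossingsOf f R p.2 p.1)) := by
  have h₁ : #(crossings R) = ∑ p : Fin k × Fin k, #(crossingsOf f R p.1 p.2) := by
    rw [card_eq_sum_card_fiberwise (f := fun q => (f q.1.1, f q.2.1)) (t := univ) (by simp)]
    refine sum_congr rfl fun p _ => ?_
    simp [crossingsOf, Prod.ext_iff]
  have h₂ : ∀ i, crossingsOf f R i i = ∅ := by
    intro i
    refine eq_empty_of_forall_notMem ?_
    rintro ⟨⟨a, b⟩, c, d⟩ h
    obtain ⟨⟨hab, hcd, h₁, h₂, h₃⟩, h₄, h₅⟩ := mem_crossingsOf.1 h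
    exact color_ne_of_chord (hR _ _ hab) (hR _ _ hcd) h₁ h₂ h₃ (h₄.trans h₅.symm)
  have h₃ : ∑ p : Fin k × Fin k with ¬ p.1 < p.2, #(crossingsOf f R p.1 p.2) =
      ∑ p : Fin k × Fin k with p.1 < p.2, #(crossingsOf f R p.2 p.1) := by
    trans ∑ p : Fin k × Fin k with p.2 < p.1, #(crossingsOf f R p.1 p.2)
    · symm
      refine sum_subset (fun p hp => ?_) ?_
      · simp only [mem_filter, mem_univ, true_and] at hp ⊢
        exact hp.asymm
      · rintro ⟨i, j⟩ hp hp'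
        simp only [mem_filter, mem_univ, true_and, not_lt] at hp hp'
        obtain rfl := le_antisymm hp hp'
        simp [h₂]
    · exact sum_nbij' Prod.swap Prod.swap (by simp) (by simp) (by simp) (by simp) (by simp)
  rw [h₁, ← sum_filter_add_sum_filter_not univ (fun p : Fin k × Fin k => p.1 < p.2), h₃,
    sum_add_distrib]

/-! ### Upper bounds -/

lemma Arc.right_unique {f : Fin n → Fin k} {a b b' : Fin n} (h : Arc f a b) (h' : Arc f a b') :
    b = b' := by
  rcases lt_trichotomy b b' with h₁ | h₁ | h₁
  · exact absurd ⟨h.1, h₁⟩ (h'.2.2 b h.2.1.symm)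
  · exact h₁
  · exact absurd ⟨h'.1, h₁⟩ (h.2.2 b' h'.2.1.symm)

lemma Arc.left_unique {f : Fin n → Fin k} {a a' b : Fin n} (h : Arc f a b) (h' : Arc f a' b) :
    a = a' := by
  have hf : f a = f a' := h.2.1.trans h'.2.1.symm
  rcases lt_trichotomy a a' with h₁ | h₁ | h₁
  · exact absurd ⟨h₁, h'.1⟩ (h.2.2 a' hf.symm)
  · exact h₁
  · exact absurd ⟨h₁, h.1⟩ (h'.2.2 a hf)

/-- At most one arc of a given colour passes over a given point. -/
lemma Arc.eq_of_between {f : Fin n → Fin k} {a b a' b' c : Fin n} (h : Arc f a b)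
    (h' : Arc f a' b') (hf : f a = f a') (hac : a < c) (hcb : c < b) (hac' : a' < c)
    (hcb' : c < b') : a = a' ∧ b = b' := by
  have : a = a' := by
    rcases lt_trichotomy a a' with h₁ | h₁ | h₁
    · exact absurd ⟨h₁, hac'.trans hcb⟩ (h.2.2 a' hf.symm)
    · exact h₁
    · exact absurd ⟨h₁, hac.trans hcb'⟩ (h'.2.2 a hf)
  subst this
  exact ⟨rfl, h.right_unique h'⟩

/-- The pairs of crossing arcs are determined by the left end of the second arc. -/
lemma card_crossingsOf_arc_le_left (f : Fin n → Fin k) (i j : Fin k) (s : Finset (Fin n))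
    (hs : ∀ a b c d, Arc f a b → Arc f c d → f a = i → f c = j → a < c → c < b → b < d → c ∈ s) :
    #(crossingsOf f (Arc f) i j) ≤ #s := by
  refine card_le_card_of_injOn (fun q => q.2.1) ?_ ?_
  · rintro ⟨⟨a, b⟩, c, d⟩ h
    obtain ⟨⟨hab, hcd, h₁, h₂, h₃⟩, h₄, h₅⟩ := mem_crossingsOf.1 h
    exact hs a b c d hab hcd h₄ h₅ h₁ h₂ h₃
  · rintro ⟨⟨a, b⟩, c, d⟩ h ⟨⟨a', b'⟩, c', d'⟩ h' hc
    obtain ⟨⟨hab, hcd, h₁, h₂, h₃⟩, h₄, h₅⟩ := mem_crossingsOf.1 h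
    obtain ⟨⟨hab', hcd', h₁', h₂', h₃'⟩, h₄', h₅'⟩ := mem_crossingsOf.1 h'
    obtain rfl : c = c' := hc
    obtain rfl := hcd.right_unique hcd'
    obtain ⟨rfl, rfl⟩ := hab.eq_of_between hab' (h₄.trans h₄'.symm) h₁ h₂ h₁' h₂'
    rfl

/-- The pairs of crossing arcs are determined by the right end of the first arc. -/
lemma card_crossingsOf_arc_le_right (f : Fin n → Fin k) (i j : Fin k) (s : Finset (Fin n))
    (hs : ∀ a b c d, Arc f a b → Arc f c d → f a = i → f c = j → a < c → c < b → b < d → b ∈ s) :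
    #(crossingsOf f (Arc f) i j) ≤ #s := by
  refine card_le_card_of_injOn (fun q => q.1.2) ?_ ?_
  · rintro ⟨⟨a, b⟩, c, d⟩ h
    obtain ⟨⟨hab, hcd, h₁, h₂, h₃⟩, h₄, h₅⟩ := mem_crossingsOf.1 h
    exact hs a b c d hab hcd h₄ h₅ h₁ h₂ h₃
  · rintro ⟨⟨a, b⟩, c, d⟩ h ⟨⟨a', b'⟩, c', d'⟩ h' hc
    obtain ⟨⟨hab, hcd, h₁, h₂, h₃⟩, h₄, h₅⟩ := mem_crossingsOf.1 h
    obtain ⟨⟨hab', hcd', h₁', h₂', h₃'⟩, h₄', h₅'⟩ := mem_crossingsOf.1 h'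
    obtain rfl : b = b' := hc
    obtain rfl := hab.left_unique hab'
    obtain ⟨rfl, rfl⟩ := hcd.eq_of_between hcd' (h₅.trans h₅'.symm) h₂ h₃ h₂' h₃'
    rfl

/-- The maximal number of crossings of two linear blocks of sizes `a ≥ b`. -/
def arcMax (a b : ℕ) : ℕ := (b - 1) + min (b - 1) (a - 2)

/-- The maximal number of crossings of two circular blocks of sizes `a ≥ b`. -/
def chordMax (a b : ℕ) : ℕ := if 3 ≤ b then 2 * b else arcMax a b

lemma exists_color_min (f : Fin n → Fin k) (i : Fin k) (hi : 1 ≤ #{c | f c = i}) :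
    ∃ m, f m = i ∧ ∀ c, f c = i → m ≤ c := by
  have h : (univ.filter fun c => f c = i).Nonempty := card_pos.1 hi
  refine ⟨_, (mem_filter.1 (min'_mem _ h)).2, fun c hc => min'_le _ _ (by simp [hc])⟩

lemma exists_color_max (f : Fin n → Fin k) (i : Fin k) (hi : 1 ≤ #{c | f c = i}) :
    ∃ m, f m = i ∧ ∀ c, f c = i → c ≤ m := by
  have h : (univ.filter fun c => f c = i).Nonempty := card_pos.1 hi
  refine ⟨_, (mem_filter.1 (max'_mem _ h)).2, fun c hc => le_max' _ _ (by simp [hc])⟩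

/-- If colour `i` starts before colour `j`, few arcs of colour `j` cross a later arc of
colour `i`. -/
lemma card_crossingsOf_arc_le_sub_two (f : Fin n → Fin k) (i j : Fin k) {m m' M : Fin n}
    (hm : f m = i) (hM : f M = i) (hm' : ∀ c, f c = j → m' ≤ c)
    (hM' : ∀ c, f c = i → c ≤ M) (h : m < m') :
    #(crossingsOf f (Arc f) j i) ≤ #{c | f c = i} - 2 := by
  have key : ∀ a b c d, Arc f a b → Arc f c d → f a = j → f c = i → a < c → c < b → b < d →
      c ≠ m ∧ c < M ∧ m < M := by
    intro a b c d hab hcd ha hc h₁ h₂ h₃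
    have h₄ := hm' a ha
    have h₅ := hM' d (hcd.2.1.symm.trans hc)
    have h₆ := hcd.1
    refine ⟨by rintro rfl; omega, by omega, by omega⟩
  rcases (hM' m hm).eq_or_lt with hmM | hmM
  · refine (card_crossingsOf_arc_le_left f j i ∅ ?_).trans (by simp)
    intro a b c d hab hcd ha hc h₁ h₂ h₃
    exact absurd (key a b c d hab hcd ha hc h₁ h₂ h₃).2.2 hmM.not_lt
  · refine (card_crossingsOf_arc_le_left f j i
      (((univ.filter fun c => f c = i).erase m).erase M) ?_).trans ?_
    · intro a b c d hab hcd ha hc h₁ h₂ h₃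
      obtain ⟨h₄, h₅, -⟩ := key a b c d hab hcd ha hc h₁ h₂ h₃
      simp only [mem_erase, mem_filter, mem_univ, true_and]
      exact ⟨h₅.ne, h₄, hc⟩
    · rw [card_erase_of_mem (by simp [hmM.ne', hM]), card_erase_of_mem (by simp [hm])]
      omega

lemma card_crossingsOf_arc_le_sub_one_left (f : Fin n → Fin k) (i j : Fin k)
    (hj : 1 ≤ #{c | f c = j}) :
    #(crossingsOf f (Arc f) i j) ≤ #{c | f c = j} - 1 := by
  obtain ⟨M, hM, hM'⟩ := exists_color_max f j hj
  refine (card_crossingsOf_arc_le_left f i j ((univ.filter fun c => f c = j).erase M) ?_).trans ?_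
  · intro a b c d hab hcd ha hc h₁ h₂ h₃
    have h₅ := hM' d (hcd.2.1.symm.trans hc)
    simp only [mem_erase, mem_filter, mem_univ, true_and]
    exact ⟨(hcd.1.trans_le h₅).ne, hc⟩
  · rw [card_erase_of_mem (by simp [hM])]

lemma card_crossingsOf_arc_le_sub_one_right (f : Fin n → Fin k) (i j : Fin k)
    (hi : 1 ≤ #{c | f c = i}) :
    #(crossingsOf f (Arc f) i j) ≤ #{c | f c = i} - 1 := by
  obtain ⟨m, hm, hm'⟩ := exists_color_min f i hi
  refine (card_crossingsOf_arc_le_right f i j ((univ.filter fun c => f c = i).erase m) ?_).trans ?_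
  · intro a b c d hab hcd ha hc h₁ h₂ h₃
    simp only [mem_erase, mem_filter, mem_univ, true_and]
    exact ⟨((hm' a ha).trans_lt hab.1).ne', hab.2.1.symm.trans ha⟩
  · rw [card_erase_of_mem (by simp [hm])]

lemma card_crossingsOf_arc_add_le (f : Fin n → Fin k) {i j : Fin k} (hij : i ≠ j)
    (hj : 1 ≤ #{c | f c = j}) (hle : #{c | f c = j} ≤ #{c | f c = i}) :
    #(crossingsOf f (Arc f) i j) + #(crossingsOf f (Arc f) j i) ≤
      arcMax #{c | f c = i} #{c | f c = j} := by
  have hi := hj.trans hle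
  have h₁ := card_crossingsOf_arc_le_sub_one_left f i j hj
  have h₂ := card_crossingsOf_arc_le_sub_one_right f j i hj
  obtain ⟨m, hm, hm'⟩ := exists_color_min f i hi
  obtain ⟨l, hl, hl'⟩ := exists_color_min f j hj
  obtain ⟨M, hM, hM'⟩ := exists_color_max f i hi
  obtain ⟨L, hL, hL'⟩ := exists_color_max f j hj
  have hml : m ≠ l := by rintro rfl; exact hij (hm.symm.trans hl)
  unfold arcMax
  rcases hml.lt_or_gt with h | h
  · have h₃ := card_crossingsOf_arc_le_sub_two f i j hm hM hl' hM' h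
    omega
  · have h₃ := card_crossingsOf_arc_le_sub_two f j i hl hL hm' hL' h
    omega

open Classical in
/-- The first point of a chord in the cyclic order of its block. -/
noncomputable def start (f : Fin n → Fin k) (c d : Fin n) : Fin n :=
  if Arc f c d then c else d

lemma Chord.closing {f : Fin n → Fin k} {a b : Fin n} (h : Chord f a b) (h' : ¬ Arc f a b) :
    3 ≤ #{c | f c = f a} ∧ ∀ c, f c = f a → a ≤ c ∧ c ≤ b :=
  h.2.2.resolve_left fun h₁ => h' ⟨h.1, h.2.1, h₁⟩

lemma Chord.arc {f : Fin n → Fin k} {a b : Fin n} (h : Chord f a b)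
    (h' : #{c | f c = f a} < 3) : Arc f a b := by
  by_contra h₁
  exact absurd (h.closing h₁).1 (by omega)

lemma Chord.eq_of_start_eq {f : Fin n → Fin k} {c d c' d' : Fin n} (h : Chord f c d)
    (h' : Chord f c' d') (hf : f c = f c') (hs : start f c d = start f c' d') :
    c = c' ∧ d = d' := by
  unfold start at hs
  split_ifs at hs with h₁ h₂ h₂
  · subst hs
    exact ⟨rfl, h₁.right_unique h₂⟩
  · have := ((h'.closing h₂).2 d (h.2.1.symm.trans hf)).2
    have := h.1
    omega
  · have := ((h.closing h₁).2 d' (h'.2.1.symm.trans hf.symm)).2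
    have := h'.1
    omega
  · have h₃ := ((h.closing h₁).2 c' hf.symm).1
    have h₄ := ((h'.closing h₂).2 c hf).1
    exact ⟨le_antisymm h₃ h₄, hs⟩

lemma Chord.eq_of_not_arc {f : Fin n → Fin k} {a b a' b' : Fin n} (h : Chord f a b)
    (h' : Chord f a' b') (hf : f a = f a') (h₁ : ¬ Arc f a b) (h₂ : ¬ Arc f a' b') :
    a = a' ∧ b = b' := by
  have h₃ := (h.closing h₁).2
  have h₄ := (h'.closing h₂).2
  exact ⟨le_antisymm (h₃ a' hf.symm).1 (h₄ a hf).1,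
    le_antisymm (h₄ b (h.2.1.symm.trans hf)).2 (h₃ b' (h'.2.1.symm.trans hf.symm)).2⟩

open Classical in
/-- Every chord of colour `j` crosses at most two chords of colour `i`. -/
lemma card_crossingsOf_chord_add_le (f : Fin n → Fin k) (i j : Fin k) (s : Finset (Fin n))
    (hs : ∀ c d, Chord f c d → f c = j → start f c d ∈ s) :
    #(crossingsOf f (Chord f) i j) + #(crossingsOf f (Chord f) j i) ≤ 2 * #s := by
  have hcard : #(s ×ˢ (univ : Finset Bool)) = 2 * #s := by simp [mul_comm]
  rw [← card_disjSum, ← hcard]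
  refine card_le_card_of_injOn
    (Sum.elim (fun q => (start f q.2.1 q.2.2, decide (Arc f q.1.1 q.1.2)))
      (fun q => (start f q.1.1 q.1.2, !decide (Arc f q.2.1 q.2.2)))) ?_ ?_
  · rintro (⟨⟨a, b⟩, c, d⟩ | ⟨⟨c, d⟩, a, b⟩) h
    · obtain ⟨⟨hab, hcd, h₁, h₂, h₃⟩, h₄, h₅⟩ := mem_crossingsOf.1 (inl_mem_disjSum.1 h)
      exact mem_coe.2 (mem_product.2 ⟨hs c d hcd h₅, mem_univ _⟩)
    · obtain ⟨⟨hcd, hab, h₁, h₂, h₃⟩, h₄, h₅⟩ := mem_crossingsOf.1 (inr_mem_disjSum.1 h)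
      exact mem_coe.2 (mem_product.2 ⟨hs c d hcd h₄, mem_univ _⟩)
  · rintro (⟨⟨a, b⟩, c, d⟩ | ⟨⟨c, d⟩, a, b⟩) h (⟨⟨a', b'⟩, c', d'⟩ | ⟨⟨c', d'⟩, a', b'⟩) h' he
    · obtain ⟨⟨hab, hcd, h₁, h₂, h₃⟩, h₄, h₅⟩ := mem_crossingsOf.1 (inl_mem_disjSum.1 h)
      obtain ⟨⟨hab', hcd', h₁', h₂', h₃'⟩, h₄', h₅'⟩ := mem_crossingsOf.1 (inl_mem_disjSum.1 h')
      simp only [Sum.elim_inl, Prod.mk.injEq, decide_eq_decide] at he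
      obtain ⟨rfl, rfl⟩ := hcd.eq_of_start_eq hcd' (h₅.trans h₅'.symm) he.1
      by_cases harc : Arc f a b
      · obtain ⟨rfl, rfl⟩ :=
          harc.eq_of_between (he.2.1 harc) (h₄.trans h₄'.symm) h₁ h₂ h₁' h₂'
        rfl
      · obtain ⟨rfl, rfl⟩ :=
          hab.eq_of_not_arc hab' (h₄.trans h₄'.symm) harc (fun h => harc (he.2.2 h))
        rfl
    · obtain ⟨⟨hab, hcd, h₁, h₂, h₃⟩, h₄, h₅⟩ := mem_crossingsOf.1 (inl_mem_disjSum.1 h)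
      obtain ⟨⟨hcd', hab', h₁', h₂', h₃'⟩, h₄', h₅'⟩ := mem_crossingsOf.1 (inr_mem_disjSum.1 h')
      simp only [Sum.elim_inl, Sum.elim_inr, Prod.mk.injEq, ← decide_not, decide_eq_decide] at he
      obtain ⟨rfl, rfl⟩ := hcd.eq_of_start_eq hcd' (h₅.trans h₄'.symm) he.1
      exfalso
      by_cases harc : Arc f a b
      · have := ((hab'.closing (he.2.1 harc)).2 a (h₄.trans h₅'.symm)).1
        omega
      · have := ((hab.closing harc).2 b' (hab'.2.1.symm.trans (h₅'.trans h₄.symm))).2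
        omega
    · obtain ⟨⟨hab, hcd, h₁, h₂, h₃⟩, h₄, h₅⟩ := mem_crossingsOf.1 (inl_mem_disjSum.1 h')
      obtain ⟨⟨hcd', hab', h₁', h₂', h₃'⟩, h₄', h₅'⟩ := mem_crossingsOf.1 (inr_mem_disjSum.1 h)
      simp only [Sum.elim_inl, Sum.elim_inr, Prod.mk.injEq, ← decide_not, decide_eq_decide] at he
      obtain ⟨rfl, rfl⟩ := hcd.eq_of_start_eq hcd' (h₅.trans h₄'.symm) he.1.symm
      exfalso
      by_cases harc : Arc f a' b'
      · have := ((hab'.closing (he.2.2 harc)).2 a' (h₄.trans h₅'.symm)).1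
        omega
      · have := ((hab.closing harc).2 b (hab'.2.1.symm.trans (h₅'.trans h₄.symm))).2
        omega
    · obtain ⟨⟨hcd, hab, h₁, h₂, h₃⟩, h₅, h₄⟩ := mem_crossingsOf.1 (inr_mem_disjSum.1 h)
      obtain ⟨⟨hcd', hab', h₁', h₂', h₃'⟩, h₅', h₄'⟩ := mem_crossingsOf.1 (inr_mem_disjSum.1 h')
      simp only [Sum.elim_inr, Prod.mk.injEq, ← decide_not, decide_eq_decide, not_iff_not] at he
      obtain ⟨rfl, rfl⟩ := hcd.eq_of_start_eq hcd' (h₅.trans h₅'.symm) he.1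
      by_cases harc : Arc f a b
      · obtain ⟨rfl, rfl⟩ :=
          harc.eq_of_between (he.2.1 harc) (h₄.trans h₄'.symm) h₂ h₃ h₂' h₃'
        rfl
      · obtain ⟨rfl, rfl⟩ :=
          hab.eq_of_not_arc hab' (h₄.trans h₄'.symm) harc (fun h => harc (he.2.2 h))
        rfl

lemma crossingsOf_chord_subset_arc (f : Fin n → Fin k) (i j : Fin k)
    (hi : #{c | f c = i} < 3) (hj : #{c | f c = j} < 3) :
    crossingsOf f (Chord f) i j ⊆ crossingsOf f (Arc f) i j := by
  rintro ⟨⟨a, b⟩, c, d⟩ h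
  obtain ⟨⟨hab, hcd, h₁⟩, rfl, rfl⟩ := mem_crossingsOf.1 h
  exact mem_crossingsOf.2 ⟨⟨hab.arc hi, hcd.arc hj, h₁⟩, rfl, rfl⟩

lemma card_crossingsOf_chord_add_le_chordMax (f : Fin n → Fin k) {i j : Fin k} (hij : i ≠ j)
    (hj : 1 ≤ #{c | f c = j}) (hle : #{c | f c = j} ≤ #{c | f c = i}) :
    #(crossingsOf f (Chord f) i j) + #(crossingsOf f (Chord f) j i) ≤
      chordMax #{c | f c = i} #{c | f c = j} := by
  unfold chordMax
  split_ifs with h3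
  · refine card_crossingsOf_chord_add_le f i j _ fun c d hcd hc => ?_
    have hd := hcd.2.1.symm.trans hc
    unfold start
    split_ifs <;> simp [hc, hd]
  · push Not at h3
    by_cases hi : #{c | f c = i} < 3
    · exact (add_le_add (card_le_card (crossingsOf_chord_subset_arc f i j hi h3))
        (card_le_card (crossingsOf_chord_subset_arc f j i h3 hi))).trans
        (card_crossingsOf_arc_add_le f hij hj hle)
    · obtain ⟨M, hM, hM'⟩ := exists_color_max f j hj
      refine (card_crossingsOf_chord_add_le f i j ((univ.filter fun c => f c = j).erase M)
        fun c d hcd hc => ?_).trans ?_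
      · have harc : Arc f c d := hcd.arc (by rw [hc]; exact h3)
        have h₅ := hM' d (hcd.2.1.symm.trans hc)
        rw [start, if_pos harc]
        simp only [mem_erase, mem_filter, mem_univ, true_and]
        exact ⟨(hcd.1.trans_le h₅).ne, hc⟩
      · rw [card_erase_of_mem (by simp [hM]), arcMax]
        omega

/-! ### The round-robin colouring -/

/-- `f` colours `Fin n` in rounds: in round `r` every colour `i` with `r < lam i` occurs once, in
increasing order, and `g` is the round. -/
structure RoundRobin (lam : Fin k → ℕ) (f : Fin n → Fin k) (g : Fin n → ℕ) : Prop where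
  lt_iff : ∀ a b, a < b ↔ g a < g b ∨ (g a = g b ∧ f a < f b)
  lt_lam : ∀ a, g a < lam (f a)
  exists_eq : ∀ i r, r < lam i → ∃ a, f a = i ∧ g a = r

lemma exists_roundRobin (lam : Fin k → ℕ) (hsum : ∑ i, lam i = n) :
    ∃ (f : Fin n → Fin k) (g : Fin n → ℕ), RoundRobin lam f g := by
  let s : Finset (ℕ ×ₗ Fin k) :=
    (univ.sigma fun i => range (lam i)).map
      ⟨fun x : (_ : Fin k) × ℕ => toLex (x.2, x.1), fun ⟨x, y⟩ ⟨x', y'⟩ h => by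
        simp only [EmbeddingLike.apply_eq_iff_eq, Prod.mk.injEq] at h
        simp [h.1, h.2]⟩
  have hs : #s = n := by simp [s, hsum]
  have hmem : ∀ x, x ∈ s ↔ (ofLex x).1 < lam (ofLex x).2 := by
    intro x
    simp only [s, mem_map, mem_sigma, mem_univ, mem_range, true_and]
    constructor
    · rintro ⟨y, hy, rfl⟩
      exact hy
    · exact fun hx => ⟨⟨(ofLex x).2, (ofLex x).1⟩, hx, rfl⟩
  let e := s.orderIsoOfFin hs
  refine ⟨fun a => (ofLex (e a).1).2, fun a => (ofLex (e a).1).1, ?_, ?_, ?_⟩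
  · intro a b
    rw [← e.lt_iff_lt, ← Subtype.coe_lt_coe, Prod.Lex.lt_iff]
  · exact fun a => (hmem _).1 (e a).2
  · intro i r hr
    refine ⟨e.symm ⟨toLex (r, i), (hmem _).2 hr⟩, ?_, ?_⟩ <;> simp

namespace RoundRobin

variable {lam : Fin k → ℕ} {f : Fin n → Fin k} {g : Fin n → ℕ}

lemma card_color (h : RoundRobin lam f g) (i : Fin k) : #{c | f c = i} = lam i := by
  rw [← card_range (lam i)]
  refine card_nbij g ?_ ?_ ?_
  · intro a ha
    have ha : f a = i := by simpa using ha
    simpa [ha] using h.lt_lam a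
  · intro a ha b hb hab
    have ha : f a = i := by simpa using ha
    have hb : f b = i := by simpa using hb
    have h₁ := h.lt_iff a b
    have h₂ := h.lt_iff b a
    simp only [hab, ha, hb, lt_self_iff_false, and_false, or_false, iff_false] at h₁ h₂
    exact le_antisymm (not_lt.1 h₂) (not_lt.1 h₁)
  · intro r hr
    obtain ⟨a, ha, hr⟩ := h.exists_eq i r (by simpa using hr)
    exact ⟨a, by simpa using ha, hr⟩

lemma lt_iff_of_color_eq (h : RoundRobin lam f g) {a b : Fin n} (hf : f a = f b) :
    a < b ↔ g a < g b := by
  simp [h.lt_iff a b, hf]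

lemma arc (h : RoundRobin lam f g) {a b : Fin n} (hf : f a = f b) (hg : g b = g a + 1) :
    Arc f a b := by
  refine ⟨(h.lt_iff_of_color_eq hf).2 (by omega), hf, fun c hc hlt => ?_⟩
  have h₁ := (h.lt_iff_of_color_eq hc.symm).1 hlt.1
  have h₂ := (h.lt_iff_of_color_eq (hc.trans hf)).1 hlt.2
  omega

lemma closing_chord (h : RoundRobin lam f g) {a b : Fin n} (hf : f a = f b) (ha : g a = 0)
    (hb : g b = lam (f a) - 1) (h3 : 3 ≤ lam (f a)) : Chord f a b ∧ ¬ Arc f a b := by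
  constructor
  · refine ⟨(h.lt_iff_of_color_eq hf).2 (by omega), hf, Or.inr ⟨by rwa [h.card_color],
      fun c hc => ?_⟩⟩
    have h₁ := h.lt_iff_of_color_eq hc
    have h₂ := h.lt_iff_of_color_eq (hf.symm.trans hc.symm)
    have h₃ := h.lt_lam c
    rw [hc] at h₃
    exact ⟨not_lt.1 fun h' => by have := h₁.1 h'; omega,
      not_lt.1 fun h' => by have := h₂.1 h'; omega⟩
  · intro harc
    obtain ⟨c, hc, hg⟩ := h.exists_eq (f a) 1 (by omega)
    exact harc.2.2 c hc ⟨(h.lt_iff_of_color_eq hc.symm).2 (by omega),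
      (h.lt_iff_of_color_eq (hc.trans hf)).2 (by omega)⟩

lemma exists_position (h : RoundRobin lam f g) (i : Fin k) (hi : 1 ≤ lam i) :
    ∃ p : Fin k → ℕ → Fin n, (∀ i r, r < lam i → f (p i r) = i ∧ g (p i r) = r) ∧
      ∀ i j r s, r < lam i → s < lam j → (r < s ∨ r = s ∧ i < j) → p i r < p j s := by
  have : Nonempty (Fin n) := ⟨(h.exists_eq i 0 hi).choose⟩
  choose! p hp using h.exists_eq
  refine ⟨p, hp, fun i j r s hr hs hlt => ?_⟩
  rw [h.lt_iff, (hp i r hr).1, (hp i r hr).2, (hp j s hs).1, (hp j s hs).2]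
  exact hlt

lemma sub_one_le_card_crossingsOf (h : RoundRobin lam f g) {i j : Fin k} (hij : i < j)
    (hj : 1 ≤ lam j) (hle : lam j ≤ lam i) :
    lam j - 1 ≤ #(crossingsOf f (Arc f) i j) := by
  obtain ⟨p, hp, hlt⟩ := h.exists_position j hj
  rw [← card_range (lam j - 1)]
  refine card_le_card_of_injOn
    (fun r => ((p i r, p i (r + 1)), (p j r, p j (r + 1)))) ?_ ?_
  · intro r hr
    have hr : r < lam j - 1 := by simpa using hr
    obtain ⟨h₁, h₁'⟩ := hp i r (by omega)
    obtain ⟨h₂, h₂'⟩ := hp i (r + 1) (by omega)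
    obtain ⟨h₃, h₃'⟩ := hp j r (by omega)
    obtain ⟨h₄, h₄'⟩ := hp j (r + 1) (by omega)
    refine mem_crossingsOf.2 ⟨⟨h.arc (h₁.trans h₂.symm) (by omega),
      h.arc (h₃.trans h₄.symm) (by omega), ?_, ?_, ?_⟩, h₁, h₃⟩ <;>
    exact hlt _ _ _ _ (by omega) (by omega) (by omega)
  · intro r hr s hs hrs
    have hr : r < lam j - 1 := by simpa using hr
    have hs : s < lam j - 1 := by simpa using hs
    simp only [Prod.mk.injEq] at hrs
    rw [← (hp i r (by omega)).2, ← (hp i s (by omega)).2, hrs.1.1]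

lemma min_le_card_crossingsOf (h : RoundRobin lam f g) {i j : Fin k} (hij : i < j)
    (hj : 1 ≤ lam j) :
    min (lam j - 1) (lam i - 2) ≤ #(crossingsOf f (Arc f) j i) := by
  obtain ⟨p, hp, hlt⟩ := h.exists_position j hj
  rw [← card_range (min (lam j - 1) (lam i - 2))]
  refine card_le_card_of_injOn
    (fun r => ((p j r, p j (r + 1)), (p i (r + 1), p i (r + 2)))) ?_ ?_
  · intro r hr
    have hr : r < min (lam j - 1) (lam i - 2) := by simpa using hr
    obtain ⟨h₁, h₁'⟩ := hp i (r + 1) (by omega)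
    obtain ⟨h₂, h₂'⟩ := hp i (r + 2) (by omega)
    obtain ⟨h₃, h₃'⟩ := hp j r (by omega)
    obtain ⟨h₄, h₄'⟩ := hp j (r + 1) (by omega)
    refine mem_crossingsOf.2 ⟨⟨h.arc (h₃.trans h₄.symm) (by omega),
      h.arc (h₁.trans h₂.symm) (by omega), ?_, ?_, ?_⟩, h₃, h₁⟩ <;>
    exact hlt _ _ _ _ (by omega) (by omega) (by omega)
  · intro r hr s hs hrs
    have hr : r < min (lam j - 1) (lam i - 2) := by simpa using hr
    have hs : s < min (lam j - 1) (lam i - 2) := by simpa using hs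
    simp only [Prod.mk.injEq] at hrs
    rw [← (hp j r (by omega)).2, ← (hp j s (by omega)).2, hrs.1.1]

lemma arcMax_le (h : RoundRobin lam f g) {i j : Fin k} (hij : i < j)
    (hj : 1 ≤ lam j) (hle : lam j ≤ lam i) :
    arcMax (lam i) (lam j) ≤ #(crossingsOf f (Arc f) i j) + #(crossingsOf f (Arc f) j i) :=
  add_le_add (h.sub_one_le_card_crossingsOf hij hj hle) (h.min_le_card_crossingsOf hij hj)

end RoundRobin

lemma crossingsOf_arc_subset_chord (f : Fin n → Fin k) (i j : Fin k) :
    crossingsOf f (Arc f) i j ⊆ crossingsOf f (Chord f) i j := by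
  rintro ⟨⟨a, b⟩, c, d⟩ h
  obtain ⟨⟨hab, hcd, h₁⟩, h₂⟩ := mem_crossingsOf.1 h
  exact mem_crossingsOf.2 ⟨⟨hab.chord, hcd.chord, h₁⟩, h₂⟩

namespace RoundRobin

variable {lam : Fin k → ℕ} {f : Fin n → Fin k} {g : Fin n → ℕ}

lemma chordMax_le_of_lt (h : RoundRobin lam f g) {i j : Fin k} (hij : i < j)
    (hj : 3 ≤ lam j) (hlt : lam j < lam i) :
    2 * lam j ≤ #(crossingsOf f (Chord f) i j) + #(crossingsOf f (Chord f) j i) := by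
  have hT := h.sub_one_le_card_crossingsOf hij (by omega) hlt.le
  have hT' := h.min_le_card_crossingsOf hij (by omega)
  obtain ⟨p, hp, hpos⟩ := h.exists_position j (by omega)
  obtain ⟨a₀, a₀'⟩ := hp i 0 (by omega)
  obtain ⟨a₁, a₁'⟩ := hp i 1 (by omega)
  obtain ⟨a₂, a₂'⟩ := hp i (lam j - 1) (by omega)
  obtain ⟨a₃, a₃'⟩ := hp i (lam j) (by omega)
  obtain ⟨b₀, b₀'⟩ := hp j 0 (by omega)
  obtain ⟨b₁, b₁'⟩ := hp j (lam j - 1) (by omega)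
  have hclose := h.closing_chord (b₀.trans b₁.symm) b₀' (by rw [b₀, b₁']) (by rwa [b₀])
  have h₁ : ((p i 0, p i 1), (p j 0, p j (lam j - 1))) ∈ crossingsOf f (Chord f) i j := by
    refine mem_crossingsOf.2 ⟨⟨(h.arc (a₀.trans a₁.symm) (by omega)).chord, hclose.1,
      ?_, ?_, ?_⟩, a₀, b₀⟩ <;>
    exact hpos _ _ _ _ (by omega) (by omega) (by omega)
  have h₁' : ((p i 0, p i 1), (p j 0, p j (lam j - 1))) ∉ crossingsOf f (Arc f) i j :=
    fun h' => hclose.2 (mem_crossingsOf.1 h').1.2.1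
  have h₂ : ((p j 0, p j (lam j - 1)), (p i (lam j - 1), p i (lam j))) ∈
      crossingsOf f (Chord f) j i := by
    refine mem_crossingsOf.2 ⟨⟨hclose.1, (h.arc (a₂.trans a₃.symm) (by omega)).chord,
      ?_, ?_, ?_⟩, b₀, a₂⟩ <;>
    exact hpos _ _ _ _ (by omega) (by omega) (by omega)
  have h₂' : ((p j 0, p j (lam j - 1)), (p i (lam j - 1), p i (lam j))) ∉
      crossingsOf f (Arc f) j i :=
    fun h' => hclose.2 (mem_crossingsOf.1 h').1.1
  have h₃ := card_le_card (insert_subset h₁ (crossingsOf_arc_subset_chord f i j))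
  have h₄ := card_le_card (insert_subset h₂ (crossingsOf_arc_subset_chord f j i))
  rw [card_insert_of_notMem h₁'] at h₃
  rw [card_insert_of_notMem h₂'] at h₄
  omega

lemma chordMax_le_of_eq (h : RoundRobin lam f g) {i j : Fin k} (hij : i < j)
    (hj : 3 ≤ lam j) (heq : lam j = lam i) :
    2 * lam j ≤ #(crossingsOf f (Chord f) i j) + #(crossingsOf f (Chord f) j i) := by
  have hT := h.sub_one_le_card_crossingsOf hij (by omega) heq.le
  have hT' := h.min_le_card_crossingsOf hij (by omega)
  obtain ⟨p, hp, hpos⟩ := h.exists_position j (by omega)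
  obtain ⟨a₀, a₀'⟩ := hp i 0 (by omega)
  obtain ⟨a₁, a₁'⟩ := hp i 1 (by omega)
  obtain ⟨a₂, a₂'⟩ := hp i (lam j - 1) (by omega)
  obtain ⟨b₀, b₀'⟩ := hp j 0 (by omega)
  obtain ⟨b₁, b₁'⟩ := hp j (lam j - 2) (by omega)
  obtain ⟨b₂, b₂'⟩ := hp j (lam j - 1) (by omega)
  have hA := h.closing_chord (a₀.trans a₂.symm) a₀' (by rw [a₀, a₂', heq]) (by rwa [a₀, ← heq])
  have hB := h.closing_chord (b₀.trans b₂.symm) b₀' (by rw [b₀, b₂']) (by rwa [b₀])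
  have h₁ : ((p i 0, p i 1), (p j 0, p j (lam j - 1))) ∈ crossingsOf f (Chord f) i j := by
    refine mem_crossingsOf.2 ⟨⟨(h.arc (a₀.trans a₁.symm) (by omega)).chord, hB.1,
      ?_, ?_, ?_⟩, a₀, b₀⟩ <;>
    exact hpos _ _ _ _ (by omega) (by omega) (by omega)
  have h₂ : ((p i 0, p i (lam j - 1)), (p j (lam j - 2), p j (lam j - 1))) ∈
      crossingsOf f (Chord f) i j := by
    refine mem_crossingsOf.2 ⟨⟨hA.1, (h.arc (b₁.trans b₂.symm) (by omega)).chord,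
      ?_, ?_, ?_⟩, a₀, b₁⟩ <;>
    exact hpos _ _ _ _ (by omega) (by omega) (by omega)
  have h₃ : ((p i 0, p i (lam j - 1)), (p j 0, p j (lam j - 1))) ∈
      crossingsOf f (Chord f) i j := by
    refine mem_crossingsOf.2 ⟨⟨hA.1, hB.1, ?_, ?_, ?_⟩, a₀, b₀⟩ <;>
    exact hpos _ _ _ _ (by omega) (by omega) (by omega)
  have h₁' : ((p i 0, p i 1), (p j 0, p j (lam j - 1))) ∉ crossingsOf f (Arc f) i j :=
    fun h' => hB.2 (mem_crossingsOf.1 h').1.2.1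
  have h₂' : ((p i 0, p i (lam j - 1)), (p j (lam j - 2), p j (lam j - 1))) ∉
      insert ((p i 0, p i 1), (p j 0, p j (lam j - 1))) (crossingsOf f (Arc f) i j) := by
    rw [mem_insert, not_or]
    refine ⟨fun h' => ?_, fun h' => hA.2 (mem_crossingsOf.1 h').1.1⟩
    have := congrArg (fun q => g q.1.2) h'
    simp only [a₂', a₁'] at this
    omega
  have h₃' : ((p i 0, p i (lam j - 1)), (p j 0, p j (lam j - 1))) ∉
      insert ((p i 0, p i (lam j - 1)), (p j (lam j - 2), p j (lam j - 1)))
        (insert ((p i 0, p i 1), (p j 0, p j (lam j - 1))) (crossingsOf f (Arc f) i j)) := by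
    rw [mem_insert, mem_insert, not_or, not_or]
    refine ⟨fun h' => ?_, fun h' => ?_, fun h' => hA.2 (mem_crossingsOf.1 h').1.1⟩
    · have := congrArg (fun q => g q.2.1) h'
      simp only [b₀', b₁'] at this
      omega
    · have := congrArg (fun q => g q.1.2) h'
      simp only [a₂', a₁'] at this
      omega
  have h₄ := card_le_card (insert_subset h₃ (insert_subset h₂ (insert_subset h₁
    (crossingsOf_arc_subset_chord f i j))))
  have h₅ := card_le_card (crossingsOf_arc_subset_chord f j i)
  rw [card_insert_of_notMem h₃', card_insert_of_notMem h₂', card_insert_of_notMem h₁'] at h₄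
  omega

lemma chordMax_le (h : RoundRobin lam f g) {i j : Fin k} (hij : i < j)
    (hj : 1 ≤ lam j) (hle : lam j ≤ lam i) :
    chordMax (lam i) (lam j) ≤
      #(crossingsOf f (Chord f) i j) + #(crossingsOf f (Chord f) j i) := by
  unfold chordMax
  split_ifs with h3
  · rcases hle.lt_or_eq with hlt | heq
    · exact h.chordMax_le_of_lt hij h3 hlt
    · exact h.chordMax_le_of_eq hij h3 heq
  · exact (h.arcMax_le hij hj hle).trans (add_le_add
      (card_le_card (crossingsOf_arc_subset_chord f i j))
      (card_le_card (crossingsOf_arc_subset_chord f j i)))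

end RoundRobin

/-! ### Set partitions and colourings -/

/-- The blocks of `π` are the colour classes of `f`. -/
def IsColoring (π : Finpartition (univ : Finset (Fin n))) (f : Fin n → Fin k) : Prop :=
  ∀ a b, sameBlock π a b ↔ f a = f b

lemma crl_eq {π : Finpartition (univ : Finset (Fin n))} {f : Fin n → Fin k}
    (h : IsColoring π f) : crl π = #(crossings (Arc f)) := by
  have harc : ∀ a b, IsArc π a b ↔ Arc f a b := by
    intro a b
    simp only [IsArc, Arc, h _ _]
    grind
  rw [crl, ← Set.ncard_coe_finset]
  congr 1
  ext ⟨⟨a, b⟩, c, d⟩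
  simp [mem_crossings, harc]

lemma crc_eq {π : Finpartition (univ : Finset (Fin n))} {f : Fin n → Fin k}
    (h : IsColoring π f) : crc π = #(crossings (Chord f)) := by
  have hB : ∀ B ∈ π.parts, ∀ a ∈ B, B = univ.filter fun c => f c = f a := by
    intro B hB a ha
    ext c
    rw [mem_filter, ← h c a]
    refine ⟨fun hc => ⟨mem_univ _, B, hB, hc, ha⟩, ?_⟩
    rintro ⟨-, B', hB', hc, ha'⟩
    rwa [π.eq_of_mem_parts hB hB' ha ha']
  have hchord : ∀ a b, IsChord π a b ↔ Chord f a b := by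
    intro a b
    constructor
    · rintro ⟨hab, B, hBπ, ha, hb, h'⟩
      rw [hB B hBπ a ha] at h'
      exact ⟨hab, (h a b).1 ⟨B, hBπ, ha, hb⟩, by simpa using h'⟩
    · rintro ⟨hab, hf, h'⟩
      obtain ⟨B, hBπ, ha, hb⟩ := (h a b).2 hf
      refine ⟨hab, B, hBπ, ha, hb, ?_⟩
      rw [hB B hBπ a ha]
      simpa using h'
  rw [crc, ← Set.ncard_coe_finset]
  congr 1
  ext ⟨⟨a, b⟩, c, d⟩
  simp [mem_crossings, hchord]

lemma exists_isColoring {lam : Fin k → ℕ} (π : Finpartition (univ : Finset (Fin n)))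
    (h : Multiset.map Finset.card π.parts.val = Multiset.map lam univ.val) :
    ∃ f : Fin n → Fin k, IsColoring π f ∧ ∀ i, #{c | f c = i} = lam i := by
  have hfib : ∀ c, Fintype.card {B : π.parts // #B.1 = c} = Fintype.card {i // lam i = c} := by
    intro c
    have := congrArg (Multiset.count c) h
    rw [Multiset.count_map, Multiset.count_map, ← filter_val, ← filter_val, card_val,
      card_val] at this
    rw [Fintype.card_subtype, Fintype.card_subtype]
    simp only [eq_comm (a := c)] at this
    rw [← this, ← card_map (Function.Embedding.subtype _)]
    congr 1
    ext B
    simp [and_comm]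
  let e : Fin k ≃ π.parts :=
    (Equiv.ofFiberEquiv fun c => Fintype.equivOfCardEq (hfib c)).symm
  have he : ∀ i, #(e i).1 = lam i := by
    intro i
    have := Equiv.ofFiberEquiv_map (fun c => Fintype.equivOfCardEq (hfib c)) (e i)
    rw [← this]
    exact congrArg lam (e.symm_apply_apply i)
  let f : Fin n → Fin k := fun a => e.symm ⟨π.part a, π.part_mem.2 (mem_univ a)⟩
  have hf : ∀ a i, f a = i ↔ a ∈ (e i).1 := by
    intro a i
    rw [Equiv.symm_apply_eq, ← π.part_eq_iff_mem (e i).2, Subtype.ext_iff]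
  refine ⟨f, fun a b => ?_, fun i => ?_⟩
  · rw [hf]
    constructor
    · rintro ⟨B, hB, ha, hb⟩
      have : (e (f b)).1 = B := π.eq_of_mem_parts (e (f b)).2 hB ((hf b _).1 rfl) hb
      rwa [this]
    · exact fun ha => ⟨_, (e (f b)).2, ha, (hf b _).1 rfl⟩
  · simp [hf, he]

lemma exists_finpartition {lam : Fin k → ℕ} (f : Fin n → Fin k) (hpos : ∀ i, 1 ≤ lam i)
    (hf : ∀ i, #{c | f c = i} = lam i) :
    ∃ π : Finpartition (univ : Finset (Fin n)),
      Multiset.map Finset.card π.parts.val = Multiset.map lam univ.val ∧ IsColoring π f := by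
  have hne : ∀ i, ∃ a, f a = i := by
    intro i
    have : 0 < #{c | f c = i} := by rw [hf]; exact hpos i
    obtain ⟨a, ha⟩ := card_pos.1 this
    exact ⟨a, by simpa using ha⟩
  let F : Fin k ↪ Finset (Fin n) := ⟨fun i => univ.filter fun c => f c = i, fun i j h => by
    obtain ⟨a, ha⟩ := hne i
    have : a ∈ univ.filter fun c => f c = j := by
      rw [← show _ = univ.filter fun c => f c = j from h]
      simpa using ha
    rw [← ha]
    simpa using this⟩
  have hF : ∀ i a, a ∈ F i ↔ f a = i := fun i a => by
    rw [show F i = univ.filter fun c => f c = i from rfl]; simp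
  let π : Finpartition (univ : Finset (Fin n)) :=
    Finpartition.ofExistsUnique (univ.map F) (fun _ _ => subset_univ _)
      (fun a _ => ⟨F (f a), by simp [hF], by
        rintro B ⟨hB, ha⟩
        obtain ⟨i, -, rfl⟩ := mem_map.1 hB
        rw [(hF i a).1 ha]⟩)
      (by
        intro h
        obtain ⟨i, -, hi⟩ := mem_map.1 h
        obtain ⟨a, ha⟩ := hne i
        have := (hF i a).2 ha
        simp [hi] at this)
  have hπ : π.parts = univ.map F := rfl
  refine ⟨π, ?_, fun a b => ?_⟩
  · rw [hπ, map_val, Multiset.map_map]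
    exact Multiset.map_congr rfl fun i _ => hf i
  · simp only [sameBlock, hπ, mem_map, mem_univ, true_and]
    constructor
    · rintro ⟨B, ⟨i, rfl⟩, ha, hb⟩
      exact ((hF i a).1 ha).trans ((hF i b).1 hb).symm
    · exact fun h => ⟨F (f a), ⟨f a, rfl⟩, (hF _ _).2 rfl, (hF _ _).2 h.symm⟩

/-! ### The maxima -/

lemma maxCrl_eq_sum_arcMax (lam : Fin k → ℕ) (hpos : ∀ i, 1 ≤ lam i)
    (hmono : ∀ i j : Fin k, i ≤ j → lam j ≤ lam i) (hsum : ∑ i, lam i = n) :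
    maxCrl n (Multiset.map lam univ.val) =
      ∑ p : Fin k × Fin k with p.1 < p.2, arcMax (lam p.1) (lam p.2) := by
  have hub : ∀ f : Fin n → Fin k, (∀ i, #{c | f c = i} = lam i) → #(crossings (Arc f)) ≤
      ∑ p : Fin k × Fin k with p.1 < p.2, arcMax (lam p.1) (lam p.2) := by
    intro f hf
    rw [card_crossings f _ fun _ _ => Arc.chord]
    refine sum_le_sum fun p hp => ?_
    have hp : p.1 < p.2 := by simpa using hp
    simpa only [hf] using card_crossingsOf_arc_add_le f hp.ne (by rw [hf]; exact hpos _)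
      (by rw [hf, hf]; exact hmono _ _ hp.le)
  refine IsGreatest.csSup_eq ⟨?_, ?_⟩
  · obtain ⟨f, g, h⟩ := exists_roundRobin lam hsum
    obtain ⟨π, hπ, hcol⟩ := exists_finpartition f hpos h.card_color
    refine ⟨π, hπ, ?_⟩
    rw [crl_eq hcol]
    refine le_antisymm (hub f h.card_color) ?_
    rw [card_crossings f _ fun _ _ => Arc.chord]
    refine sum_le_sum fun p hp => ?_
    have hp : p.1 < p.2 := by simpa using hp
    exact h.arcMax_le hp (hpos _) (hmono _ _ hp.le)
  · rintro c ⟨π, hπ, rfl⟩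
    obtain ⟨f, hcol, hf⟩ := exists_isColoring π hπ
    rw [crl_eq hcol]
    exact hub f hf

lemma maxCrc_eq_sum_chordMax (lam : Fin k → ℕ) (hpos : ∀ i, 1 ≤ lam i)
    (hmono : ∀ i j : Fin k, i ≤ j → lam j ≤ lam i) (hsum : ∑ i, lam i = n) :
    maxCrc n (Multiset.map lam univ.val) =
      ∑ p : Fin k × Fin k with p.1 < p.2, chordMax (lam p.1) (lam p.2) := by
  have hub : ∀ f : Fin n → Fin k, (∀ i, #{c | f c = i} = lam i) → #(crossings (Chord f)) ≤
      ∑ p : Fin k × Fin k with p.1 < p.2, chordMax (lam p.1) (lam p.2) := by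
    intro f hf
    rw [card_crossings f _ fun _ _ => id]
    refine sum_le_sum fun p hp => ?_
    have hp : p.1 < p.2 := by simpa using hp
    simpa only [hf] using card_crossingsOf_chord_add_le_chordMax f hp.ne
      (by rw [hf]; exact hpos _) (by rw [hf, hf]; exact hmono _ _ hp.le)
  refine IsGreatest.csSup_eq ⟨?_, ?_⟩
  · obtain ⟨f, g, h⟩ := exists_roundRobin lam hsum
    obtain ⟨π, hπ, hcol⟩ := exists_finpartition f hpos h.card_color
    refine ⟨π, hπ, ?_⟩
    rw [crc_eq hcol]
    refine le_antisymm (hub f h.card_color) ?_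
    rw [card_crossings f _ fun _ _ => id]
    refine sum_le_sum fun p hp => ?_
    have hp : p.1 < p.2 := by simpa using hp
    exact h.chordMax_le hp (hpos _) (hmono _ _ hp.le)
  · rintro c ⟨π, hπ, rfl⟩
    obtain ⟨f, hcol, hf⟩ := exists_isColoring π hπ
    rw [crc_eq hcol]
    exact hub f hf

lemma filter_lt_fin_two :
    (univ.filter fun p : Fin 2 × Fin 2 => p.1 < p.2) = {(0, 1)} := by
  decide

lemma map_pair_univ (a b : ℕ) : Multiset.map ![a, b] univ.val = {a, b} := by
  rfl

lemma maxCrl_pair {a b : ℕ} (hb : 1 ≤ b) (hba : b ≤ a) :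
    maxCrl (a + b) {a, b} = arcMax a b := by
  have h := maxCrl_eq_sum_arcMax (n := a + b) ![a, b]
    (by simp [Fin.forall_fin_two, hb, hb.trans hba]) (by simp [Fin.forall_fin_two, hba]) (by simp)
  rw [map_pair_univ, filter_lt_fin_two, sum_singleton] at h
  exact h

lemma maxCrc_pair {a b : ℕ} (hb : 1 ≤ b) (hba : b ≤ a) :
    maxCrc (a + b) {a, b} = chordMax a b := by
  have h := maxCrc_eq_sum_chordMax (n := a + b) ![a, b]
    (by simp [Fin.forall_fin_two, hb, hb.trans hba]) (by simp [Fin.forall_fin_two, hba]) (by simp)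
  rw [map_pair_univ, filter_lt_fin_two, sum_singleton] at h
  exact h

end ColoredCrossing

/-- For an integer partition `λ = (λ₁ ≥ ⋯ ≥ λ_k)` of `n`, the maximum crossing number
`M^u(λ)` is the sum over pairs `i < j` of the two-block maxima `M^u(λ_i, λ_j)`,
for `u ∈ {ℓ, c}`. -/
theorem max_cr_pairwise (n k : ℕ) (lam : Fin k → ℕ) (hpos : ∀ i, 1 ≤ lam i)
    (hmono : ∀ i j : Fin k, i ≤ j → lam j ≤ lam i) (hsum : ∑ i, lam i = n) :
    maxCrl n (Multiset.map lam Finset.univ.val) =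
      ∑ p ∈ Finset.univ.filter (fun p : Fin k × Fin k => p.1 < p.2),
        maxCrl (lam p.1 + lam p.2) {lam p.1, lam p.2} ∧
    maxCrc n (Multiset.map lam Finset.univ.val) =
      ∑ p ∈ Finset.univ.filter (fun p : Fin k × Fin k => p.1 < p.2),
        maxCrc (lam p.1 + lam p.2) {lam p.1, lam p.2} := by
  constructor
  · rw [ColoredCrossing.maxCrl_eq_sum_arcMax lam hpos hmono hsum]
    refine sum_congr rfl fun p hp => ?_
    have hp : p.1 < p.2 := by simpa using hp
    exact (ColoredCrossing.maxCrl_pair (hpos _) (hmono _ _ hp.le)).symm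
  · rw [ColoredCrossing.maxCrc_eq_sum_chordMax lam hpos hmono hsum]
    refine sum_congr rfl fun p hp => ?_
    have hp : p.1 < p.2 := by simpa using hp
    exact (ColoredCrossing.maxCrc_pair (hpos _) (hmono _ _ hp.le)).symm
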